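/- Let a ∈ (0,1], ε > 0, C > 0 and p₀ ∈ ℝ⁴. For each real R > 1, let θ̄_R ∈ ℝ⁶ satisfy ‖θ̄_R‖ ≤ C·log R, let D_R denote the product of the closed ball in ℝ⁴ of radius ε centered at p₀ with the closed ball in ℝ⁶ of radius R^{1−a}·log R centered at θ̄_R, and let ℐ_R : ℝ⁴ × ℝ⁶ → ℝ⁴ × ℝ⁶ be continuous on D_R and of the form ℐ_R(θ₁, θ₂) = (θ₁ − p₀, R^{−1}(θ₂ − θ̄_R)) + ℐ⁰_R(θ₁, θ₂), where ‖ℐ⁰_R(θ)‖ ≤ C·(R^{−a}(log R)^{1/2} + ‖θ‖²·R^{−2}) for all θ ∈ D_R. Then there exists R₁ > 1 such that for every R ≥ R₁ there is θ ∈ D_R with ℐ_R(θ) = 0. -/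

import Mathlib

namespace BrouwerAux

open MeasureTheory Metric Set Polynomial

theorem det_poly {E : Type*} [NormedAddCommGroup E] [NormedSpace ℝ E] [FiniteDimensional ℝ E]
    (A : E →L[ℝ] E) : ∃ p : ℝ[X], p.natDegree ≤ Module.finrank ℝ E ∧
      ∀ t : ℝ, p.eval t = (ContinuousLinearMap.id ℝ E + t • A).det := by
  let b := Module.finBasis ℝ E
  let M := LinearMap.toMatrix b b (A : E →ₗ[ℝ] E)
  refine ⟨((X : ℝ[X]) • M.map C + (1 : Matrix _ _ ℝ).map C).det, ?_, ?_⟩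
  · simpa using natDegree_det_X_add_C_le M 1
  · intro t
    have h1 : (ContinuousLinearMap.id ℝ E + t • A).det = (1 + t • M).det := by
      rw [ContinuousLinearMap.det, ← LinearMap.det_toMatrix b]
      congr 1
      simp [M]
    rw [h1, ← coe_evalRingHom, RingHom.map_det]
    congr 1
    ext i j
    by_cases hij : i = j <;> simp [hij] <;> ring

theorem interp (n : ℕ) (t0 : ℝ) (h : 0 < t0) : ∃ (v w : ℕ → ℝ), (∀ i ∈ Finset.range (n+1), 0 ≤ v i ∧ v i ≤ t0) ∧
    ∀ p : ℝ[X], p.natDegree ≤ n → p.eval 1 = ∑ i ∈ Finset.range (n+1), w i * p.eval (v i) := by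
  let v : ℕ → ℝ := fun i => t0 * i / (n + 1)
  refine ⟨v, fun i => (Lagrange.basis (Finset.range (n+1)) v i).eval 1, ?_, ?_⟩
  · intro i hi
    have : (i : ℝ) ≤ n + 1 := by
      have := Finset.mem_range.1 hi
      exact_mod_cast this.le
    refine ⟨by positivity, ?_⟩
    simp only [v]
    rw [div_le_iff₀ (by positivity)]
    nlinarith
  · intro p hp
    have hinj : Set.InjOn v (Finset.range (n+1) : Finset ℕ) := by
      intro i _ j _ hij
      simp only [v] at hij
      field_simp at hij
      exact_mod_cast hij
    have := Lagrange.eq_interpolate (s := Finset.range (n+1)) (v := v) (f := p) hinj (by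
      rw [Finset.card_range]
      refine lt_of_le_of_lt degree_le_natDegree ?_
      exact_mod_cast Nat.lt_succ_of_le hp)
    conv_lhs => rw [this]
    rw [Lagrange.interpolate_apply, eval_finsetSum]
    simp [mul_comm]

theorem det_zero_of_sphere {E : Type*} [NormedAddCommGroup E] [InnerProductSpace ℝ E] [FiniteDimensional ℝ E]
    (r : E → E) (hr : Differentiable ℝ r) (ρ : ℝ) (hρ : 0 < ρ) (hn : ∀ x, ‖r x‖ = ρ) (x : E) :
    (fderiv ℝ r x).det = 0 := by
  by_contra hdet
  have hdet' : LinearMap.det (fderiv ℝ r x : E →ₗ[ℝ] E) ≠ 0 := hdet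
  have hu := LinearMap.isUnit_iff_isUnit_det _ |>.2 (isUnit_iff_ne_zero.2 hdet')
  have hs : Function.Surjective (fderiv ℝ r x : E →ₗ[ℝ] E) := ((Module.End.isUnit_iff _).1 hu).2
  obtain ⟨v, hv⟩ := hs (r x)
  have h1 : HasFDerivAt (fun y => inner ℝ (r y) (r y)) _ x :=
    (hr x).hasFDerivAt.inner ℝ (hr x).hasFDerivAt
  have h2 : (fun y => inner ℝ (r y) (r y)) = fun _ => ρ^2 := by
    ext y; rw [real_inner_self_eq_norm_sq, hn]
  rw [h2] at h1
  have h3 := congrArg (fun L => L v) (h1.unique (hasFDerivAt_const _ _))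
  have hv' : fderiv ℝ r x v = r x := hv
  simp [hv', hn] at h3
  exact hρ.ne' h3

theorem lip_ext {E : Type*} [NormedAddCommGroup E] [NormedSpace ℝ E]
    (g : E → E) (ρ : ℝ) (K : NNReal) (hK : LipschitzOnWith K g (closedBall 0 ρ))
    (h0 : ∀ x, ‖x‖ = ρ → g x = 0) : LipschitzWith K ((closedBall (0:E) ρ).indicator g) := by
  have key : ∀ x y : E, x ∈ closedBall (0:E) ρ → y ∉ closedBall (0:E) ρ → ‖g x‖ ≤ K * dist x y := by
    intro x y hx hy
    have hx' := hx
    simp only [mem_closedBall, dist_zero_right, not_le] at hx hy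
    obtain ⟨z, hz, hzρ⟩ := (convex_segment (𝕜 := ℝ) x y).isPreconnected.intermediate_value
      (left_mem_segment ℝ x y) (right_mem_segment ℝ x y) (continuous_norm.continuousOn) ⟨hx, hy.le⟩
    have h1 := hK.dist_le_mul x hx' z (by simp [hzρ])
    rw [h0 z hzρ, dist_zero_right] at h1
    refine h1.trans ?_
    gcongr
    have := dist_add_dist_of_mem_segment hz
    linarith [dist_nonneg (x := z) (y := y)]
  refine LipschitzWith.of_dist_le_mul fun x y => ?_
  by_cases hx : x ∈ closedBall (0:E) ρ <;> by_cases hy : y ∈ closedBall (0:E) ρ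
  · rw [indicator_of_mem hx, indicator_of_mem hy]; exact hK.dist_le_mul x hx y hy
  · rw [indicator_of_mem hx, indicator_of_notMem hy, dist_zero_right]; exact key x y hx hy
  · rw [indicator_of_notMem hx, indicator_of_mem hy, dist_zero_left, dist_comm]; exact key y x hy hx
  · rw [indicator_of_notMem hx, indicator_of_notMem hy, dist_self]; positivity

/-- small perturbations of identity are bijective -/
theorem bij_small {E : Type*} [NormedAddCommGroup E] [NormedSpace ℝ E] [CompleteSpace E]
    (G : E → E) (K : NNReal) (hK : LipschitzWith K G) (t : ℝ) (ht : 0 ≤ t) (htK : t * K < 1) :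
    Function.Bijective fun x => x + t • G x := by
  have hd : ∀ x y, ‖t • G x - t • G y‖ ≤ t * K * ‖x - y‖ := by
    intro x y
    rw [← smul_sub, norm_smul, Real.norm_of_nonneg ht, mul_assoc]
    gcongr
    simpa [dist_eq_norm] using hK.dist_le_mul x y
  constructor
  · intro x y hxy
    have h1 : x - y = -(t • G x - t • G y) := by
      have : x + t • G x = y + t • G y := hxy
      rw [neg_sub, sub_eq_sub_iff_add_eq_add, this, add_comm]
    have h2 := hd x y
    rw [← norm_neg, ← h1] at h2
    have : ‖x - y‖ = 0 := by nlinarith [norm_nonneg (x - y)]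
    exact sub_eq_zero.1 (norm_eq_zero.1 this)
  · intro y
    have hc : ContractingWith (Real.toNNReal (t * K)) (fun x => y - t • G x) := by
      refine ⟨by simpa using htK, LipschitzWith.of_dist_le_mul fun x z => ?_⟩
      rw [Real.coe_toNNReal _ (by positivity), dist_eq_norm, dist_eq_norm, sub_sub_sub_cancel_left, norm_sub_rev]
      exact hd x z
    refine ⟨hc.fixedPoint, ?_⟩
    have : y - t • G hc.fixedPoint = hc.fixedPoint := hc.fixedPoint_isFixedPt
    show hc.fixedPoint + t • G hc.fixedPoint = y
    conv_lhs => enter [1]; rw [← this]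
    simp

theorem no_retraction {E : Type*} [NormedAddCommGroup E] [InnerProductSpace ℝ E] [FiniteDimensional ℝ E]
    (r : E → E) (hr : ContDiff ℝ 1 r) (ρ : ℝ) (hρ : 0 < ρ) (hn : ∀ x, ‖r x‖ = ρ)
    (hid : ∀ x, ‖x‖ = ρ → r x = x) : False := by
  let _ : MeasurableSpace E := borel E
  have : BorelSpace E := ⟨rfl⟩
  let μ : Measure E := Measure.addHaar
  let B : Set E := closedBall 0 ρ
  have hBc : IsCompact B := isCompact_closedBall 0 ρ
  let g : E → E := fun x => r x - x
  have hg : ContDiff ℝ 1 g := hr.sub contDiff_id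
  have hg' : Continuous (fderiv ℝ g) := hg.continuous_fderiv one_ne_zero
  have hgd : ∀ x, HasFDerivAt g (fderiv ℝ g x) x := fun x =>
    (hg.differentiable one_ne_zero x).hasFDerivAt
  obtain ⟨K, hK⟩ := (hg.locallyLipschitz.locallyLipschitzOn (s := B)).exists_lipschitzOnWith_of_compact hBc
  have hG := lip_ext g ρ K hK (fun x hx => by simp [g, hid x hx])
  obtain ⟨M, hM⟩ := hBc.exists_bound_of_continuousOn (f := fderiv ℝ g) hg'.continuousOn
  have hM0 : 0 ≤ M := (norm_nonneg _).trans (hM 0 (by simp [B, hρ.le]))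
  -- determinant positivity near the identity
  have hdetc : Continuous fun A : E →L[ℝ] E => (ContinuousLinearMap.id ℝ E + A).det :=
    ContinuousLinearMap.continuous_det.comp (continuous_const.add continuous_id)
  have hopen : {A : E →L[ℝ] E | 0 < (ContinuousLinearMap.id ℝ E + A).det} ∈ nhds 0 := by
    refine (isOpen_lt continuous_const hdetc).mem_nhds ?_
    simp [ContinuousLinearMap.det]
  obtain ⟨η, hη, hηs⟩ := Metric.mem_nhds_iff.1 hopen
  let t0 : ℝ := min (1 / (K + 1)) (η / (2 * (M + 1)))
  have ht0 : 0 < t0 := by positivity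
  have hvol : ∀ t, 0 ≤ t → t ≤ t0 →
      ∫ x in B, (ContinuousLinearMap.id ℝ E + t • fderiv ℝ g x).det ∂μ = μ.real B := by
    intro t ht htt
    have htK : t * K < 1 := by
      have h1 : t ≤ 1 / (K + 1) := htt.trans (min_le_left _ _)
      rw [le_div_iff₀ (by positivity)] at h1
      rcases ht.eq_or_lt with h | h
      · simp [← h]
      · linarith
    have hbij := bij_small _ K hG t ht htK
    have heq : ∀ x ∈ B, x + t • g x = x + t • B.indicator g x := fun x hx => by
      rw [indicator_of_mem hx]
    have hout : ∀ x, x ∉ B → x + t • B.indicator g x = x := fun x hx => by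
      rw [indicator_of_notMem hx]; simp
    have himg : (fun x => x + t • g x) '' B = B := by
      ext y
      constructor
      · rintro ⟨x, hx, rfl⟩
        by_contra hy
        have h1 := hout _ hy
        simp only [heq x hx] at h1 hy
        have h2 := hbij.1 h1
        exact hy (by rw [h2]; exact hx)
      · intro hy
        obtain ⟨x, hx⟩ := hbij.2 y
        simp only at hx
        have hxB : x ∈ B := by
          by_contra hxB
          rw [hout x hxB] at hx
          exact hxB (hx ▸ hy)
        exact ⟨x, hxB, (heq x hxB).trans hx⟩
    have hinj : InjOn (fun x => x + t • g x) B := by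
      intro x hx y hy hxy
      simp only [heq x hx, heq y hy] at hxy
      exact hbij.1 hxy
    have hcv := integral_image_eq_integral_abs_det_fderiv_smul μ (s := B)
      (f := fun x => x + t • g x) (f' := fun x => ContinuousLinearMap.id ℝ E + t • fderiv ℝ g x)
      hBc.measurableSet
      (fun x _ => ((hasFDerivAt_id x).add ((hgd x).const_smul t)).hasFDerivWithinAt) hinj
      (fun _ => (1 : ℝ))
    rw [himg] at hcv
    simp only [smul_eq_mul, mul_one, integral_const, measureReal_restrict_apply_univ] at hcv
    rw [hcv]
    refine setIntegral_congr_fun hBc.measurableSet fun x hx => ?_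
    have : t • fderiv ℝ g x ∈ ball (0 : E →L[ℝ] E) η := by
      rw [mem_ball_zero_iff, norm_smul, Real.norm_of_nonneg ht]
      have h1 : t ≤ η / (2 * (M + 1)) := htt.trans (min_le_right _ _)
      rw [le_div_iff₀ (by positivity)] at h1
      have h2 := hM x hx
      nlinarith
    exact (abs_of_pos (hηs this)).symm
  obtain ⟨v, w, hv, hvw⟩ := interp (Module.finrank ℝ E) t0 ht0
  have hpt : ∀ x, (0 : ℝ) = ∑ i ∈ Finset.range (Module.finrank ℝ E + 1),
      w i * (ContinuousLinearMap.id ℝ E + v i • fderiv ℝ g x).det := by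
    intro x
    obtain ⟨p, hp, hpe⟩ := det_poly (fderiv ℝ g x)
    have h1 := hvw p hp
    simp only [hpe] at h1
    rw [← h1]
    have h2 : ContinuousLinearMap.id ℝ E + (1:ℝ) • fderiv ℝ g x = fderiv ℝ r x := by
      have h3 : HasFDerivAt g (fderiv ℝ r x - ContinuousLinearMap.id ℝ E) x :=
        (hr.differentiable one_ne_zero x).hasFDerivAt.sub (hasFDerivAt_id x)
      rw [h3.fderiv]; simp
    rw [h2, det_zero_of_sphere r (hr.differentiable one_ne_zero) ρ hρ hn]
  have hsum1 : (1 : ℝ) = ∑ i ∈ Finset.range (Module.finrank ℝ E + 1), w i := by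
    simpa using hvw 1 (by simp)
  have hint : ∀ t : ℝ, IntegrableOn
      (fun x => (ContinuousLinearMap.id ℝ E + t • fderiv ℝ g x).det) B μ := fun t =>
    (hdetc.comp (hg'.const_smul t)).continuousOn.integrableOn_compact hBc
  have h0 : (0 : ℝ) = μ.real B := by
    calc (0 : ℝ) = ∫ x in B, (0 : ℝ) ∂μ := by simp
      _ = ∫ x in B, ∑ i ∈ Finset.range (Module.finrank ℝ E + 1),
          w i * (ContinuousLinearMap.id ℝ E + v i • fderiv ℝ g x).det ∂μ := by
        congr 1; ext x; exact hpt x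
      _ = ∑ i ∈ Finset.range (Module.finrank ℝ E + 1), w i * μ.real B := by
        rw [integral_finsetSum _ (fun i _ => (hint (v i)).const_mul (w i))]
        refine Finset.sum_congr rfl fun i hi => ?_
        rw [integral_const_mul, hvol _ (hv i hi).1 (hv i hi).2]
      _ = μ.real B := by rw [← Finset.sum_mul, ← hsum1, one_mul]
  have hpos : 0 < μ.real B := by
    rw [measureReal_def]
    exact ENNReal.toReal_pos (measure_closedBall_pos μ 0 hρ).ne' hBc.measure_lt_top.ne
  exact hpos.ne h0

theorem exists_zero {E : Type*} [NormedAddCommGroup E] [InnerProductSpace ℝ E] [FiniteDimensional ℝ E]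
    (H : E → E) (hH : Continuous H) (M : ℝ) (hM : ∀ x, ‖H x‖ ≤ M) : ∃ x, x + H x = 0 := by
  by_contra! hne
  have hM0 : 0 ≤ M := (norm_nonneg _).trans (hM 0)
  obtain ⟨P, hP, hPd, -⟩ := hH.exists_contDiff_approx 1 (ε := fun x => min 1 ‖x + H x‖)
    (by fun_prop) (fun x => lt_min one_pos (norm_pos_iff.2 (hne x)))
  let χ : ContDiffBump (0 : E) := ⟨M + 1, M + 2, by linarith, by linarith⟩
  have hPM : ∀ x, ‖P x‖ < M + 1 := fun x => by
    have h1 := (hPd x).trans_le (min_le_left _ _)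
    rw [dist_eq_norm] at h1
    have h2 := norm_sub_norm_le (P x) (H x)
    linarith [hM x]
  let F : E → E := fun x => x + χ x • P x
  have hF : ContDiff ℝ 1 F := contDiff_id.add (χ.contDiff.smul hP)
  have hF0 : ∀ x, F x ≠ 0 := by
    intro x hx
    by_cases hxb : x ∈ closedBall (0:E) (M + 1)
    · have h1 : χ x = 1 := χ.one_of_mem_closedBall hxb
      simp only [F, h1, one_smul] at hx
      have h2 := (hPd x).trans_le (min_le_right _ _)
      rw [dist_eq_norm] at h2
      have h3 : P x - H x = -(x + H x) := by
        rw [eq_neg_of_add_eq_zero_right hx]; abel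
      rw [h3, norm_neg] at h2
      exact lt_irrefl _ h2
    · simp only [mem_closedBall, dist_zero_right, not_le] at hxb
      have h1 : x = -(χ x • P x) := eq_neg_of_add_eq_zero_left hx
      have h2 : ‖x‖ ≤ ‖P x‖ := by
        conv_lhs => rw [h1]
        rw [norm_neg, norm_smul, Real.norm_of_nonneg χ.nonneg]
        exact mul_le_of_le_one_left (norm_nonneg _) χ.le_one
      linarith [hPM x]
  refine no_retraction (fun x => ((M + 2) * ‖F x‖⁻¹) • F x) ?_ (M + 2) (by linarith) ?_ ?_
  · exact (contDiff_const.mul ((hF.norm ℝ hF0).inv fun x => norm_ne_zero_iff.2 (hF0 x))).smul hF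
  · intro x
    have := norm_pos_iff.2 (hF0 x)
    rw [norm_smul, Real.norm_of_nonneg (by positivity)]
    field_simp
  · intro x hx
    have h1 : χ x = 0 := χ.zero_of_le_dist (by simp [χ, hx])
    have h2 : F x = x := by simp [F, h1]
    have : M + 2 ≠ 0 := by linarith
    simp only [h2, hx, mul_inv_cancel₀ this, one_smul]

/-- radial retraction onto a closed ball -/
noncomputable def rad {E : Type*} [NormedAddCommGroup E] [NormedSpace ℝ E] (c : E) (s : ℝ) (x : E) : E :=
  c + (s / max s ‖x - c‖) • (x - c)

theorem rad_cont {E : Type*} [NormedAddCommGroup E] [NormedSpace ℝ E] (c : E) (s : ℝ) (hs : 0 < s) :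
    Continuous (rad c s) := by
  unfold rad
  refine continuous_const.add (Continuous.smul (continuous_const.div (by fun_prop) fun x => ?_) (by fun_prop))
  exact (lt_max_of_lt_left hs).ne'

theorem rad_mem {E : Type*} [NormedAddCommGroup E] [NormedSpace ℝ E] (c : E) (s : ℝ) (hs : 0 < s) (x : E) :
    rad c s x ∈ closedBall c s := by
  have h : 0 < max s ‖x - c‖ := lt_max_of_lt_left hs
  rw [mem_closedBall, dist_eq_norm, rad, add_sub_cancel_left, norm_smul, Real.norm_of_nonneg (by positivity),
    div_mul_eq_mul_div, div_le_iff₀ h]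
  gcongr
  exact le_max_right _ _

theorem rad_eq {E : Type*} [NormedAddCommGroup E] [NormedSpace ℝ E] (c : E) (s : ℝ) (hs : 0 < s) (x : E)
    (hx : x ∈ closedBall c s) : rad c s x = x := by
  rw [mem_closedBall, dist_eq_norm] at hx
  rw [rad, max_eq_left hx, div_self hs.ne', one_smul, add_sub_cancel]

theorem brouwer_prod {E F : Type*} [NormedAddCommGroup E] [InnerProductSpace ℝ E] [FiniteDimensional ℝ E]
    [NormedAddCommGroup F] [InnerProductSpace ℝ F] [FiniteDimensional ℝ F]
    (c : E) (d : F) (s t : ℝ) (hs : 0 < s) (ht : 0 < t) (f : E × F → E × F)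
    (hf : ContinuousOn f (closedBall c s ×ˢ closedBall d t))
    (hm : MapsTo f (closedBall c s ×ˢ closedBall d t) (closedBall c s ×ˢ closedBall d t)) :
    ∃ x ∈ closedBall c s ×ˢ closedBall d t, f x = x := by
  let D := closedBall c s ×ˢ closedBall d t
  have hD : IsCompact D := (isCompact_closedBall c s).prod (isCompact_closedBall d t)
  let e := WithLp.prodContinuousLinearEquiv 2 ℝ E F
  let π : E × F → E × F := fun x => (rad c s x.1, rad d t x.2)
  have hπ : Continuous π := ((rad_cont c s hs).comp continuous_fst).prodMk ((rad_cont d t ht).comp continuous_snd)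
  have hπm : ∀ x, π x ∈ D := fun x => ⟨rad_mem c s hs _, rad_mem d t ht _⟩
  have hfπ : Continuous fun x => f (π x) := hf.comp_continuous hπ hπm
  obtain ⟨M, hM⟩ := hD.exists_bound_of_continuousOn (f := fun y => e.symm y) e.symm.continuous.continuousOn
  obtain ⟨x, hx⟩ := exists_zero (E := WithLp 2 (E × F)) (fun x => -e.symm (f (π (e x))))
    (e.symm.continuous.comp (hfπ.comp e.continuous)).neg M
    (fun x => by rw [norm_neg]; exact hM _ (hm (hπm _)))
  have h1 : e x = f (π (e x)) := by
    rw [add_neg_eq_zero] at hx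
    conv_lhs => rw [hx]
    simp
  have h2 : e x ∈ D := by rw [h1]; exact hm (hπm _)
  have h3 : π (e x) = e x := Prod.ext (rad_eq c s hs _ h2.1) (rad_eq d t ht _ h2.2)
  exact ⟨e x, h2, by rw [h3] at h1; exact h1.symm⟩

theorem ev_bound (a ε' K : ℝ) (ha0 : 0 < a) (hε : 0 < ε') :
    ∃ R₁ : ℝ, 1 < R₁ ∧ ∀ R, R₁ ≤ R → R ^ (-a) * Real.log R ≤ ε' ∧ K ≤ Real.log R := by
  have h1 : Filter.Tendsto (fun R : ℝ => R ^ (-a) * Real.log R) Filter.atTop (nhds 0) := by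
    refine ((isLittleO_log_rpow_atTop ha0).tendsto_div_nhds_zero).congr' ?_
    filter_upwards [Filter.eventually_gt_atTop 0] with R hR
    rw [Real.rpow_neg hR.le, div_eq_inv_mul]
  have h2 := (h1.eventually_le_const hε).and (Real.tendsto_log_atTop.eventually_ge_atTop K)
  obtain ⟨R0, hR0⟩ := Filter.eventually_atTop.1 h2
  exact ⟨max R0 2, lt_max_of_lt_right (by norm_num), fun R hR => hR0 R ((le_max_left _ _).trans hR)⟩

end BrouwerAux

open BrouwerAux in
/-- The degree-argument lemma (Lemma 4.6). -/
theorem stmt_5 (a ε C : ℝ) (ha0 : 0 < a) (ha1 : a ≤ 1) (hε : 0 < ε) (hC : 0 < C)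
    (p₀ : EuclideanSpace ℝ (Fin 4))
    (θbar : ℝ → EuclideanSpace ℝ (Fin 6))
    (I I0 : ℝ → EuclideanSpace ℝ (Fin 4) × EuclideanSpace ℝ (Fin 6) →
      EuclideanSpace ℝ (Fin 4) × EuclideanSpace ℝ (Fin 6))
    (hθbar : ∀ R : ℝ, 1 < R → ‖θbar R‖ ≤ C * Real.log R)
    (hcont : ∀ R : ℝ, 1 < R → ContinuousOn (I R)
      (Metric.closedBall p₀ ε ×ˢ Metric.closedBall (θbar R) (R ^ (1 - a) * Real.log R)))
    (hform : ∀ R : ℝ, 1 < R → ∀ θ ∈ Metric.closedBall p₀ ε ×ˢ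
        Metric.closedBall (θbar R) (R ^ (1 - a) * Real.log R),
      I R θ = (θ.1 - p₀, R⁻¹ • (θ.2 - θbar R)) + I0 R θ)
    (hI0 : ∀ R : ℝ, 1 < R → ∀ θ ∈ Metric.closedBall p₀ ε ×ˢ
        Metric.closedBall (θbar R) (R ^ (1 - a) * Real.log R),
      ‖I0 R θ‖ ≤ C * (R ^ (-a) * Real.sqrt (Real.log R) + ‖θ‖ ^ 2 * R ^ (-2 : ℝ))) :
    ∃ R₁ : ℝ, 1 < R₁ ∧ ∀ R : ℝ, R₁ ≤ R →
      ∃ θ ∈ Metric.closedBall p₀ ε ×ˢ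
        Metric.closedBall (θbar R) (R ^ (1 - a) * Real.log R), I R θ = 0 := by
  set K : ℝ := ‖p₀‖ + ε + C + 1 with hKdef
  have hK : 0 < K := by positivity
  obtain ⟨R₁, hR₁, hb⟩ := ev_bound a (min ε (1 / (2 * C * K ^ 2))) (4 * C ^ 2 + 1) ha0 (by positivity)
  refine ⟨R₁, hR₁, fun R hR => ?_⟩
  have hR1 : 1 < R := lt_of_lt_of_le hR₁ hR
  have hR0 : 0 < R := by linarith
  obtain ⟨hb1, hb2⟩ := hb R hR
  have hbε := hb1.trans (min_le_left _ _)
  have hbK := hb1.trans (min_le_right _ _)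
  set L := Real.log R with hL
  have hL1 : 1 ≤ L := by nlinarith [sq_nonneg C]
  set x := R ^ (-a) with hx
  have hx0 : 0 < x := Real.rpow_pos_of_pos hR0 _
  have hRx : R ^ (1 - a) = R * x := by
    rw [hx, sub_eq_add_neg, Real.rpow_add hR0, Real.rpow_one]
  have hRx1 : 1 ≤ R * x := by
    rw [← hRx]; exact Real.one_le_rpow hR1.le (by linarith)
  have hR2 : R ^ (-2 : ℝ) = (R ^ 2)⁻¹ := by
    rw [Real.rpow_neg hR0.le]; norm_num
  have hθ := hθbar R hR1
  have hc := hcont R hR1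
  have hf := hform R hR1
  have hi := hI0 R hR1
  rw [← hL] at hθ hc hf hi
  rw [hRx] at hc hf hi ⊢
  have hRxL : 0 < R * x * L := by positivity
  -- the error is at most `x * L`
  have herr : ∀ θ ∈ Metric.closedBall p₀ ε ×ˢ Metric.closedBall (θbar R) (R * x * L),
      ‖I0 R θ‖ ≤ x * L := by
    intro θ hθm
    refine (hi θ hθm).trans ?_
    have hN : ‖θ‖ ≤ K * (R * x * L) := by
      have hone : 1 ≤ R * x * L := by nlinarith
      have hLle : L ≤ R * x * L := by nlinarith
      have e1 : ‖θ.1‖ ≤ ‖p₀‖ + ε := by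
        have h := hθm.1
        rw [Metric.mem_closedBall, dist_eq_norm] at h
        linarith [norm_sub_norm_le θ.1 p₀]
      have e2 : ‖θ.2‖ ≤ C * L + R * x * L := by
        have h := hθm.2
        rw [Metric.mem_closedBall, dist_eq_norm] at h
        linarith [norm_sub_norm_le θ.2 (θbar R)]
      have hp := norm_nonneg p₀
      rw [Prod.norm_def]
      refine max_le ?_ ?_
      · nlinarith
      · have : C * L ≤ C * (R * x * L) := by gcongr
        have : 0 ≤ (‖p₀‖ + ε) * (R * x * L) := by positivity
        rw [hKdef]; linarith
    have h1 : ‖θ‖ ^ 2 * R ^ (-2 : ℝ) ≤ K ^ 2 * x ^ 2 * L ^ 2 := by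
      rw [hR2, ← div_eq_mul_inv, div_le_iff₀ (by positivity)]
      calc ‖θ‖ ^ 2 ≤ (K * (R * x * L)) ^ 2 := by gcongr
        _ = _ := by ring
    have h2 : C * Real.sqrt L ≤ L / 2 := by
      have hs : 2 * C ≤ Real.sqrt L := Real.le_sqrt_of_sq_le (by nlinarith)
      have hq : Real.sqrt L * Real.sqrt L = L := Real.mul_self_sqrt (by linarith)
      nlinarith [Real.sqrt_nonneg L]
    have h3 : C * (K ^ 2 * (x * L)) ≤ 1 / 2 := by
      rw [le_div_iff₀ (by positivity)] at hbK
      linarith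
    calc C * (x * Real.sqrt L + ‖θ‖ ^ 2 * R ^ (-2 : ℝ))
        ≤ C * (x * Real.sqrt L + K ^ 2 * x ^ 2 * L ^ 2) := by gcongr
      _ = x * (C * Real.sqrt L) + (C * (K ^ 2 * (x * L))) * (x * L) := by ring
      _ ≤ x * (L / 2) + 1 / 2 * (x * L) := by gcongr
      _ = x * L := by ring
  obtain ⟨θ, hθm, hfix⟩ := brouwer_prod p₀ (θbar R) ε (R * x * L) hε hRxL
    (fun θ => (θ.1 - (I R θ).1, θ.2 - R • (I R θ).2))
    ((continuous_fst.continuousOn.sub (continuous_fst.comp_continuousOn hc)).prodMk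
      (continuous_snd.continuousOn.sub ((continuous_snd.comp_continuousOn hc).const_smul R)))
    (by
      intro θ hθm
      have h1 := herr θ hθm
      have h2 := (norm_fst_le (I0 R θ)).trans h1
      have h3 := (norm_snd_le (I0 R θ)).trans h1
      have h4 := hf θ hθm
      constructor
      · rw [Metric.mem_closedBall, dist_eq_norm]
        have : θ.1 - (I R θ).1 - p₀ = -(I0 R θ).1 := by
          rw [h4, Prod.fst_add]; dsimp only; abel
        simp only [this, norm_neg]
        exact h2.trans hbε
      · rw [Metric.mem_closedBall, dist_eq_norm]
        have : θ.2 - R • (I R θ).2 - θbar R = -(R • (I0 R θ).2) := by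
          rw [h4, Prod.snd_add, smul_add]; dsimp only; rw [smul_inv_smul₀ hR0.ne']; abel
        simp only [this, norm_neg]
        rw [norm_smul, Real.norm_of_nonneg hR0.le, mul_assoc]
        gcongr)
  refine ⟨θ, hθm, ?_⟩
  have hf1 := congrArg Prod.fst hfix
  have hf2 := congrArg Prod.snd hfix
  simp only [sub_eq_self, smul_eq_zero, hR0.ne', false_or] at hf1 hf2
  exact Prod.ext hf1 hf2
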